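/- arXiv:1402.1589 — 12 statements merged into one kernel-verified Lean document; each statement's English description precedes it below -/
import Mathlib

section
/- Let L be a bounded distributive lattice and let G ⊆ L be a set that generates L (i.e., the smallest sublattice of L containing G together with ⊥ and ⊤ is L itself). Then every ultrafilter p of L is generated by p ∩ G; that is, for every a ∈ p there exists a finite set s ⊆ p ∩ G whose infimum satisfies ⨅ s ≤ a. -/
/-- A filter in a bounded lattice: `⊥ ∉ F`, `⊤ ∈ F`, and `F` is upward closed
under finite meets. -/
def IsLatticeFilter {L : Type*} [Lattice L] [BoundedOrder L] (F : Set L) : Prop :=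
  ⊥ ∉ F ∧ ⊤ ∈ F ∧ ∀ a ∈ F, ∀ b ∈ F, ∀ x : L, a ⊓ b ≤ x → x ∈ F

/-- An ultrafilter of a bounded lattice: a maximal filter. -/
def IsUltraLatFilter {L : Type*} [Lattice L] [BoundedOrder L] (F : Set L) : Prop :=
  IsLatticeFilter F ∧ ∀ G : Set L, IsLatticeFilter G → F ⊆ G → G = F

/-- Ultrafilters of a bounded distributive lattice are prime. -/
theorem IsUltraLatFilter.mem_or_mem {L : Type*} [DistribLattice L] [BoundedOrder L]
    {p : Set L} (hp : IsUltraLatFilter p) {x y : L} (hxy : x ⊔ y ∈ p) : x ∈ p ∨ y ∈ p := by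
  obtain ⟨⟨_, htop, hmem⟩, hmax⟩ := hp
  by_cases h : ∃ a ∈ p, a ⊓ x ≤ ⊥
  · obtain ⟨a, ha, hax⟩ := h
    refine Or.inr (hmem a ha _ hxy y ?_)
    rw [inf_sup_left]
    exact sup_le (hax.trans bot_le) inf_le_right
  · have hF : IsLatticeFilter {z : L | ∃ a ∈ p, a ⊓ x ≤ z} := by
      refine ⟨h, ⟨⊤, htop, le_top⟩, ?_⟩
      rintro b ⟨c, hc, hcb⟩ d ⟨e, he, hed⟩ z hz
      refine ⟨c ⊓ e, hmem c hc e he _ le_rfl, ?_⟩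
      rw [inf_inf_distrib_right]
      exact (inf_le_inf hcb hed).trans hz
    have hFp := hmax _ hF fun a ha => ⟨a, ha, inf_le_left⟩
    exact Or.inl (hFp ▸ (⟨⊤, htop, inf_le_right⟩ : ∃ a ∈ p, a ⊓ x ≤ x))

/-- If `G` generates the bounded distributive lattice `L` (the only sublattice of `L`
containing `G`, `⊥` and `⊤` is `L` itself), then every ultrafilter `p` of `L`
is generated by `p ∩ G`: for every `a ∈ p` there is a finite `s ⊆ p ∩ G` with `⨅ s ≤ a`. -/
theorem ultrafilter_generated_by_inter {L : Type*} [DistribLattice L] [BoundedOrder L]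
    (G : Set L)
    (hgen : ∀ K : Sublattice L, G ⊆ (K : Set L) → (⊥ : L) ∈ K → (⊤ : L) ∈ K →
      ∀ x : L, x ∈ K)
    (p : Set L) (hp : IsUltraLatFilter p) :
    ∀ a ∈ p, ∃ s : Finset L, ↑s ⊆ p ∩ G ∧ s.inf id ≤ a := by
  classical
  obtain ⟨hbot, -, hmem⟩ := hp.1
  have hup : ∀ {x y : L}, x ∈ p → x ≤ y → y ∈ p := fun hx hxy =>
    hmem _ hx _ hx _ (inf_le_left.trans hxy)
  let K : Sublattice L :=
    { carrier := {a | a ∈ p → ∃ s : Finset L, ↑s ⊆ p ∩ G ∧ s.inf id ≤ a}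
      supClosed' := by
        intro x hx y hy hxy
        rcases hp.mem_or_mem hxy with h | h
        · obtain ⟨s, hs, hle⟩ := hx h
          exact ⟨s, hs, hle.trans le_sup_left⟩
        · obtain ⟨s, hs, hle⟩ := hy h
          exact ⟨s, hs, hle.trans le_sup_right⟩
      infClosed' := by
        intro x hx y hy hxy
        obtain ⟨s, hs, hsx⟩ := hx (hup hxy inf_le_left)
        obtain ⟨t, ht, hty⟩ := hy (hup hxy inf_le_right)
        refine ⟨s ∪ t, ?_, ?_⟩
        · rw [Finset.coe_union]
          exact Set.union_subset hs ht
        · rw [Finset.inf_union]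
          exact inf_le_inf hsx hty }
  refine hgen K (fun g hg hgp => ⟨{g}, ?_, ?_⟩) (fun h => absurd h hbot)
    (fun _ => ⟨∅, by simp, le_top⟩)
  · simpa using ⟨hgp, hg⟩
  · simp
end

section
/- Let L be a normal bounded distributive lattice. Then every prime filter F of L extends to a unique ultrafilter; moreover, this unique ultrafilter is exactly the set p_F = {a ∈ L : for all b ∈ F, a ⊓ b ≠ ⊥}. -/
/-- A prime filter of a bounded lattice. -/
def IsPrimeLatFilter {L : Type*} [Lattice L] [BoundedOrder L] (F : Set L) : Prop :=
  IsLatticeFilter F ∧ ∀ a b : L, a ⊔ b ∈ F → a ∈ F ∨ b ∈ F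

/-- A bounded distributive lattice is normal if disjoint elements can be "separated". -/
def IsNormalLat (L : Type*) [Lattice L] [BoundedOrder L] : Prop :=
  ∀ a b : L, a ⊓ b = ⊥ → ∃ a₁ b₁ : L, a₁ ⊓ b = ⊥ ∧ a ⊓ b₁ = ⊥ ∧ a₁ ⊔ b₁ = ⊤

theorem IsLatticeFilter.inf_mem {L : Type*} [Lattice L] [BoundedOrder L] {F : Set L}
    (hF : IsLatticeFilter F) {a b : L} (ha : a ∈ F) (hb : b ∈ F) : a ⊓ b ∈ F :=
  hF.2.2 a ha b hb _ le_rfl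

/-- Every filter containing `F` consists of elements that meet all members of `F`. -/
theorem IsLatticeFilter.subset_meeting {L : Type*} [Lattice L] [BoundedOrder L] {F G : Set L}
    (hG : IsLatticeFilter G) (hFG : F ⊆ G) : G ⊆ {a : L | ∀ b ∈ F, a ⊓ b ≠ ⊥} :=
  fun _ ha _ hb hab => hG.1 (hab ▸ hG.inf_mem ha (hFG hb))

/-- In a normal lattice, the elements meeting all members of a prime filter form a filter. -/
theorem IsPrimeLatFilter.isLatticeFilter_meeting {L : Type*} [Lattice L] [BoundedOrder L]
    (hnorm : IsNormalLat L) {F : Set L} (hF : IsPrimeLatFilter F) :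
    IsLatticeFilter {a : L | ∀ b ∈ F, a ⊓ b ≠ ⊥} := by
  refine ⟨fun h => h ⊤ hF.1.2.1 (bot_inf_eq _), hF.1.subset_meeting subset_rfl hF.1.2.1, ?_⟩
  intro a ha b hb x hx c hc hxc
  have habc : a ⊓ (b ⊓ c) = ⊥ := by
    rw [← inf_assoc, ← le_bot_iff, ← hxc]
    exact inf_le_inf_right c hx
  obtain ⟨a₁, b₁, h₁, h₂, h₃⟩ := hnorm _ _ habc
  rcases hF.2 a₁ b₁ (h₃ ▸ hF.1.2.1) with h | h
  · exact hb _ (hF.1.inf_mem h hc) (by rwa [inf_left_comm])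
  · exact ha _ h h₂

/-- In a normal bounded distributive lattice, every prime filter `F` extends to a
unique ultrafilter, namely `p_F = {a : ∀ b ∈ F, a ⊓ b ≠ ⊥}`. -/
theorem prime_filter_extends_uniquely {L : Type*} [DistribLattice L] [BoundedOrder L]
    (hnorm : IsNormalLat L) (F : Set L) (hF : IsPrimeLatFilter F) :
    IsUltraLatFilter {a : L | ∀ b ∈ F, a ⊓ b ≠ ⊥} ∧
    F ⊆ {a : L | ∀ b ∈ F, a ⊓ b ≠ ⊥} ∧
    ∀ q : Set L, IsUltraLatFilter q → F ⊆ q → q = {a : L | ∀ b ∈ F, a ⊓ b ≠ ⊥} := by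
  have hp := hF.isLatticeFilter_meeting hnorm
  have hFp := hF.1.subset_meeting subset_rfl
  refine ⟨⟨hp, fun G hG hpG => ?_⟩, hFp, fun q hq hFq => ?_⟩
  · exact (hG.subset_meeting (hFp.trans hpG)).antisymm hpG
  · exact (hq.2 _ hp (hq.1.subset_meeting hFq)).symm
end

section
/- Let L be a bounded distributive lattice and let Pf L be the set of prime filters of L equipped with the Wallman topology, generated by the sets a⁻ = {p ∈ Pf L : a ∉ p} for a ∈ L. Then the space Pf L is compact and T₀. -/
/-- `Pf L`: the set of prime filters of `L`. -/
abbrev PrimeFilterSpace (L : Type*) [Lattice L] [BoundedOrder L] :=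
  {F : Set L // IsPrimeLatFilter F}

/-- The Wallman topology on `Pf L`, generated by the sets `a⁻ = {p : a ∉ p}`. -/
instance (L : Type*) [Lattice L] [BoundedOrder L] :
    TopologicalSpace (PrimeFilterSpace L) :=
  TopologicalSpace.generateFrom
    {S : Set (PrimeFilterSpace L) | ∃ a : L, S = {p : PrimeFilterSpace L | a ∉ p.1}}

namespace PrimeFilterSpace

variable {L : Type*} [Lattice L] [BoundedOrder L]

theorem isOpen_setOf_notMem (a : L) : IsOpen {p : PrimeFilterSpace L | a ∉ p.1} :=
  TopologicalSpace.isOpen_generateFrom_of_mem ⟨a, rfl⟩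

/-- The set of all `a` contained in `U`-almost every prime filter, which is a limit of the
ultrafilter `U`. -/
def ultrafilterLim (U : Ultrafilter (PrimeFilterSpace L)) : PrimeFilterSpace L where
  val := {a | ∀ᶠ p in (U : Filter (PrimeFilterSpace L)), a ∈ p.1}
  property := by
    refine ⟨⟨fun h => ?_, ?_, fun a ha b hb x hx => ?_⟩, fun a b h => ?_⟩
    · obtain ⟨p, hp⟩ := Filter.Eventually.exists h
      exact p.2.1.1 hp
    · exact Filter.Eventually.of_forall fun p => p.2.1.2.1
    · exact Filter.Eventually.mp ha (Filter.Eventually.mono hb fun p hpb hpa =>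
        p.2.1.2.2 a hpa b hpb x hx)
    · exact Ultrafilter.eventually_or.1 (Filter.Eventually.mono h fun p hp => p.2.2 a b hp)

theorem le_nhds_ultrafilterLim (U : Ultrafilter (PrimeFilterSpace L)) :
    (U : Filter (PrimeFilterSpace L)) ≤ nhds (ultrafilterLim U) := by
  rw [TopologicalSpace.nhds_generateFrom]
  refine le_iInf₂ ?_
  rintro _ ⟨ha, a, rfl⟩
  exact Filter.le_principal_iff.2 (Ultrafilter.eventually_not.2 ha)

instance : CompactSpace (PrimeFilterSpace L) where
  isCompact_univ := isCompact_iff_ultrafilter_le_nhds.2 fun U _ =>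
    ⟨ultrafilterLim U, Set.mem_univ _, le_nhds_ultrafilterLim U⟩

instance : T0Space (PrimeFilterSpace L) where
  t0 p q h := by
    refine Subtype.ext (Set.ext fun a => ?_)
    exact not_iff_not.1 (h.mem_open_iff (isOpen_setOf_notMem a))

end PrimeFilterSpace

/-- The space of prime filters of a bounded distributive lattice, with the Wallman
topology, is compact and `T₀`. -/
theorem primeFilterSpace_compact_t0 (L : Type*) [DistribLattice L] [BoundedOrder L] :
    CompactSpace (PrimeFilterSpace L) ∧ T0Space (PrimeFilterSpace L) := by
  exact ⟨inferInstance, inferInstance⟩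
end

section
/- Let L be a bounded distributive lattice and let Pf L be the set of prime filters of L with the Wallman topology. A closed subset F ⊆ Pf L is of the form a⁺ = {p ∈ Pf L : a ∈ p} for some a ∈ L if and only if its complement Pf L \ F is compact. -/
open Order TopologicalSpace

/-- The subbasic open set `a⁻ = {p : a ∉ p}` of the Wallman topology. -/
def PrimeFilterSpace.minus {L : Type*} [Lattice L] [BoundedOrder L] (a : L) :
    Set (PrimeFilterSpace L) :=
  {p | a ∉ p.1}

section Lattice

variable {L : Type*} [Lattice L] [BoundedOrder L]

theorem IsLatticeFilter.mem_of_le {F : Set L} (hF : IsLatticeFilter F) {a b : L} (ha : a ∈ F)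
    (hab : a ≤ b) : b ∈ F :=
  hF.2.2 a ha a ha b (inf_le_left.trans hab)

theorem IsLatticeFilter.finset_inf_mem_iff {F : Set L} (hF : IsLatticeFilter F) (t : Finset L) :
    t.inf id ∈ F ↔ ∀ b ∈ t, b ∈ F := by
  classical
  refine ⟨fun h b hb => hF.mem_of_le h (Finset.inf_le (f := id) hb), fun h => ?_⟩
  induction t using Finset.induction_on with
  | empty => simpa using hF.2.1
  | insert b t _ ih =>
    rw [Finset.inf_insert]
    exact hF.2.2 _ (h b (Finset.mem_insert_self b t)) _
      (ih fun c hc => h c (Finset.mem_insert_of_mem hc)) _ le_rfl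

/-- The filter of all elements lying above a finite meet of elements of `B`. -/
theorem isPFilter_setOf_finset_inf_le (B : Set L) :
    IsPFilter {x : L | ∃ t : Finset L, ↑t ⊆ B ∧ t.inf id ≤ x} := by
  classical
  refine IsPFilter.of_def ⟨⊤, ∅, by simp, le_top⟩ ?_ ?_
  · rintro x ⟨s, hs, hsx⟩ y ⟨t, ht, hty⟩
    refine ⟨x ⊓ y, ⟨s ∪ t, by simp [hs, ht], ?_⟩, inf_le_left, inf_le_right⟩
    rw [Finset.inf_union]
    exact inf_le_inf hsx hty
  · rintro x y hxy ⟨t, ht, htx⟩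
    exact ⟨t, ht, htx.trans hxy⟩

theorem Order.Ideal.IsPrime.isPrimeLatFilter_compl {J : Ideal L} (hJ : J.IsPrime) :
    IsPrimeLatFilter (J : Set L)ᶜ := by
  refine ⟨⟨fun h => h J.bot_mem, ?_, fun a ha b hb x hx hxJ => ?_⟩, fun a b hab => ?_⟩
  · exact hJ.toIsProper.top_notMem
  · exact (hJ.mem_or_mem (J.lower hx hxJ)).elim ha hb
  · by_contra! h
    exact hab (J.sup_mem (not_not.1 h.1) (not_not.1 h.2))

namespace PrimeFilterSpace

theorem minus_inter_minus (a b : L) : minus a ∩ minus b = minus (a ⊔ b) := by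
  ext p
  refine ⟨fun h hab => (p.2.2 a b hab).elim h.1 h.2, fun h => ⟨fun ha => h ?_, fun hb => h ?_⟩⟩
  · exact p.2.1.mem_of_le ha le_sup_left
  · exact p.2.1.mem_of_le hb le_sup_right

theorem eq_generateFrom_range_minus :
    (inferInstance : TopologicalSpace (PrimeFilterSpace L)) =
      generateFrom (Set.range minus) := by
  change generateFrom _ = _
  congr 1
  ext S
  exact exists_congr fun a => eq_comm

theorem isTopologicalBasis_range_minus :
    IsTopologicalBasis (Set.range (minus : L → Set (PrimeFilterSpace L))) := by
  have h := isTopologicalBasis_of_subbasis_of_inter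
    (eq_generateFrom_range_minus (L := L)) (by
      rintro _ ⟨a, rfl⟩ _ ⟨b, rfl⟩
      exact ⟨a ⊔ b, (minus_inter_minus a b).symm⟩)
  rwa [Set.insert_eq_of_mem] at h
  exact ⟨⊥, Set.eq_univ_of_forall fun p => p.2.1.1⟩

theorem biUnion_minus (t : Finset L) : ⋃ b ∈ t, minus b = minus (t.inf id) := by
  ext p
  simp [minus, p.2.1.finset_inf_mem_iff]

end PrimeFilterSpace

end Lattice

section DistribLattice

variable {L : Type*} [DistribLattice L] [BoundedOrder L]

/-- If no finite meet of elements of `B` lies below `a`, some prime filter contains `B` and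
omits `a`. -/
theorem exists_primeFilter_of_forall_finset_inf_not_le {B : Set L} {a : L}
    (h : ∀ t : Finset L, ↑t ⊆ B → ¬ t.inf id ≤ a) :
    ∃ p : PrimeFilterSpace L, B ⊆ p.1 ∧ a ∉ p.1 := by
  have hdisj : Disjoint ((isPFilter_setOf_finset_inf_le B).toPFilter : Set L)
      (Ideal.principal a : Set L) := by
    rw [Set.disjoint_left]
    rintro x ⟨t, ht, htx⟩ hxa
    exact h t ht (htx.trans hxa)
  obtain ⟨J, hJ, haJ, hBJ⟩ := DistribLattice.prime_ideal_of_disjoint_filter_ideal hdisj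
  refine ⟨⟨_, hJ.isPrimeLatFilter_compl⟩, fun b hb => ?_, fun ha => ha ?_⟩
  · exact Set.disjoint_left.1 hBJ ⟨{b}, by simpa using hb, by simp⟩
  · exact haJ (Ideal.mem_principal.2 le_rfl)

namespace PrimeFilterSpace

theorem isCompact_minus (a : L) : IsCompact (minus a) := by
  classical
  refine isCompact_generateFrom eq_generateFrom_range_minus fun P hP hcover => ?_
  obtain ⟨t, htP, hta⟩ : ∃ t : Finset L, ↑t ⊆ {b : L | minus b ∈ P} ∧ t.inf id ≤ a := by
    by_contra! h
    obtain ⟨p, hBp, hap⟩ := exists_primeFilter_of_forall_finset_inf_not_le h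
    obtain ⟨S, hSP, hpS⟩ := hcover hap
    obtain ⟨b, rfl⟩ := hP hSP
    exact hpS (hBp hSP)
  refine ⟨minus '' (t : Set L), Set.image_subset_iff.2 htP, t.finite_toSet.image _, ?_⟩
  rw [Set.sUnion_image]
  simp only [Finset.mem_coe, biUnion_minus]
  exact fun p hp ht => hp (p.2.1.mem_of_le ht hta)

end PrimeFilterSpace

end DistribLattice

/-- A closed subset `F` of `Pf L` is of the form `a⁺ = {p : a ∈ p}` for some `a ∈ L`
if and only if its complement is compact. -/
theorem closed_eq_plus_iff_compl_compact (L : Type*) [DistribLattice L] [BoundedOrder L]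
    (F : Set (PrimeFilterSpace L)) (hF : IsClosed F) :
    (∃ a : L, F = {p : PrimeFilterSpace L | a ∈ p.1}) ↔ IsCompact Fᶜ := by
  constructor
  · rintro ⟨a, rfl⟩
    exact PrimeFilterSpace.isCompact_minus a
  · intro hc
    obtain ⟨s, hs, hFs⟩ := eq_finite_iUnion_of_isTopologicalBasis_of_isCompact_open _
      PrimeFilterSpace.isTopologicalBasis_range_minus _ hc hF.isOpen_compl
    lift s to Finset L using hs
    simp only [Finset.mem_coe, PrimeFilterSpace.biUnion_minus] at hFs
    exact ⟨s.inf id, compl_injective hFs⟩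
end

section
/- Every finite separative bounded distributive lattice is a Boolean algebra; that is, if L is a finite bounded distributive lattice which is separative, then every element of L has a complement. -/
/-- A bounded lattice is separative if whenever `⊥ < a` and `a ≰ b` there is
`c` with `⊥ < c ≤ a` and `c ⊓ b = ⊥`. -/
def IsSeparativeLat (L : Type*) [Lattice L] [BoundedOrder L] : Prop :=
  ∀ a b : L, ⊥ < a → ¬a ≤ b → ∃ c : L, ⊥ < c ∧ c ≤ a ∧ c ⊓ b = ⊥

/-- Every finite separative bounded distributive lattice is a Boolean algebra:
every element has a complement. -/
theorem finite_separative_distrib_lattice_is_boolean (L : Type*)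
    [DistribLattice L] [BoundedOrder L] [Finite L]
    (hsep : IsSeparativeLat L) :
    ∀ a : L, ∃ b : L, a ⊓ b = ⊥ ∧ a ⊔ b = ⊤ := by
  intro a
  obtain ⟨b, hab, hmax⟩ :=
    (Set.toFinite {b : L | a ⊓ b = ⊥}).exists_maximal ⟨⊥, inf_bot_eq a⟩
  refine ⟨b, hab, ?_⟩
  by_contra hne
  have htop : ¬(⊤ : L) ≤ a ⊔ b := fun h => hne (top_le_iff.mp h)
  have hpos : (⊥ : L) < ⊤ := bot_le.lt_of_not_ge fun h => htop (h.trans bot_le)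
  obtain ⟨c, hc, -, hdisj⟩ := hsep ⊤ (a ⊔ b) hpos htop
  have hac : a ⊓ c = ⊥ :=
    le_bot_iff.mp (hdisj ▸ le_inf inf_le_right (inf_le_left.trans le_sup_left))
  have habc : a ⊓ (b ⊔ c) = ⊥ := by
    rw [inf_sup_left, show a ⊓ b = ⊥ from hab, hac, sup_bot_eq]
  have hcb : c ≤ b := le_sup_right.trans (hmax habc le_sup_left)
  exact hc.ne' (by rw [← hdisj, inf_eq_left.mpr (hcb.trans le_sup_right)])
end

section
/- Let K and L be normal bounded distributive lattices and let h : K → L be a bounded lattice homomorphism. For p ∈ Ult L, the preimage h⁻¹(p) is a prime filter of K and hence extends to a unique ultrafilter of K; let f : Ult L → Ult K send p to this unique ultrafilter. Then f is continuous with respect to the Wallman topologies. -/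
/-- `Ult L`: the set of ultrafilters of `L`. -/
abbrev UltraFilterSpace (L : Type*) [Lattice L] [BoundedOrder L] :=
  {F : Set L // IsUltraLatFilter F}

/-- The Wallman topology on `Ult L`, generated by the sets `a⁻ = {p : a ∉ p}`. -/
instance (L : Type*) [Lattice L] [BoundedOrder L] :
    TopologicalSpace (UltraFilterSpace L) :=
  TopologicalSpace.generateFrom
    {S : Set (UltraFilterSpace L) | ∃ a : L, S = {p : UltraFilterSpace L | a ∉ p.1}}

theorem IsLatticeFilter.inf_ne_bot {L : Type*} [Lattice L] [BoundedOrder L] {F : Set L}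
    (hF : IsLatticeFilter F) {a b : L} (ha : a ∈ F) (hb : b ∈ F) : a ⊓ b ≠ ⊥ :=
  fun hab => hF.1 (hab ▸ hF.inf_mem ha hb)

theorem IsUltraLatFilter.exists_inf_eq_bot {L : Type*} [Lattice L] [BoundedOrder L] {F : Set L}
    (hF : IsUltraLatFilter F) {a : L} (ha : a ∉ F) : ∃ c ∈ F, a ⊓ c = ⊥ := by
  by_contra! hne
  have hG : IsLatticeFilter {x : L | ∃ c ∈ F, a ⊓ c ≤ x} := by
    refine ⟨?_, ⟨⊤, hF.1.2.1, le_top⟩, ?_⟩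
    · rintro ⟨c, hc, hle⟩
      exact hne c hc (le_bot_iff.mp hle)
    · rintro x ⟨c, hc, hcx⟩ y ⟨d, hd, hdy⟩ z hz
      exact ⟨c ⊓ d, hF.1.inf_mem hc hd, (le_inf ((inf_le_inf_left a inf_le_left).trans hcx)
        ((inf_le_inf_left a inf_le_right).trans hdy)).trans hz⟩
  have hGF := hF.2 _ hG fun x hx => ⟨x, hx, inf_le_right⟩
  exact ha (hGF ▸ ⟨⊤, hF.1.2.1, inf_le_left⟩)

theorem IsUltraLatFilter.isPrimeLatFilter {L : Type*} [DistribLattice L] [BoundedOrder L]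
    {F : Set L} (hF : IsUltraLatFilter F) : IsPrimeLatFilter F := by
  refine ⟨hF.1, fun a b hab => ?_⟩
  by_contra! hn
  obtain ⟨c, hc, hac⟩ := hF.exists_inf_eq_bot hn.1
  obtain ⟨d, hd, hbd⟩ := hF.exists_inf_eq_bot hn.2
  refine hF.1.inf_ne_bot hab (hF.1.inf_mem hc hd) ?_
  rw [inf_sup_right, ← inf_assoc, hac, bot_inf_eq, inf_left_comm, hbd, inf_bot_eq, bot_sup_eq]

theorem IsPrimeLatFilter.preimage {K L : Type*} [Lattice K] [BoundedOrder K] [Lattice L]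
    [BoundedOrder L] {F : Set L} (hF : IsPrimeLatFilter F) (h : BoundedLatticeHom K L) :
    IsPrimeLatFilter (⇑h ⁻¹' F) := by
  refine ⟨⟨?_, ?_, fun a ha b hb x hx => ?_⟩, fun a b hab => ?_⟩
  · simpa using hF.1.1
  · simpa using hF.1.2.1
  · exact hF.1.2.2 (h a) ha (h b) hb (h x) ((map_inf h a b).ge.trans (OrderHomClass.mono h hx))
  · rw [Set.mem_preimage, map_sup] at hab
    exact hF.2 _ _ hab

/-- Given a bounded lattice homomorphism `h : K → L` of normal bounded distributive
lattices, for every ultrafilter `p` of `L` the preimage `h⁻¹(p)` is a prime filter of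
`K` (hence extends to a unique ultrafilter), and the induced map
`f : Ult L → Ult K` — any map with `h⁻¹(p) ⊆ f p` for all `p`, i.e. the map sending
`p` to the unique ultrafilter extending `h⁻¹(p)` — is continuous. -/
theorem induced_map_continuous {K L : Type*}
    [DistribLattice K] [BoundedOrder K] [DistribLattice L] [BoundedOrder L]
    (hK : IsNormalLat K) (hL : IsNormalLat L) (h : BoundedLatticeHom K L) :
    (∀ p : UltraFilterSpace L, IsPrimeLatFilter (⇑h ⁻¹' p.1)) ∧
    ∀ f : UltraFilterSpace L → UltraFilterSpace K,
      (∀ p : UltraFilterSpace L, ⇑h ⁻¹' p.1 ⊆ (f p).1) → Continuous f := by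
  refine ⟨fun p => p.2.isPrimeLatFilter.preimage h, fun f hf => ?_⟩
  refine continuous_generateFrom_iff.mpr ?_
  rintro _ ⟨a, rfl⟩
  refine isOpen_iff_forall_mem_open.mpr fun p hp => ?_
  obtain ⟨c, hc, hac⟩ := (f p).2.exists_inf_eq_bot hp
  obtain ⟨a₁, c₁, ha₁, hc₁, htop⟩ := hK a c hac
  refine ⟨{q | h a₁ ∉ q.1}, fun q hq haq => ?_,
    TopologicalSpace.isOpen_generateFrom_of_mem ⟨h a₁, rfl⟩,
    fun hp₁ => (f p).2.1.inf_ne_bot (hf p hp₁) hc ha₁⟩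
  have hprime := q.2.isPrimeLatFilter.preimage h
  have hq₁ := (hprime.2 a₁ c₁ (htop ▸ hprime.1.2.1)).resolve_left hq
  exact (f q).2.1.inf_ne_bot haq (hf q hq₁) hc₁
end

section
/- Let K and L be normal bounded distributive lattices and let h : K → L be a bounded lattice homomorphism such that h⁻¹({⊥}) = {⊥} (i.e., h(a) = ⊥ implies a = ⊥). Then the induced map Ult h : Ult L → Ult K is surjective. -/
theorem IsLatticeFilter.sUnion_of_isChain {L : Type*} [Lattice L] [BoundedOrder L]
    {c : Set (Set L)} (hc : ∀ G ∈ c, IsLatticeFilter G) (hchain : IsChain (· ⊆ ·) c)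
    (hne : c.Nonempty) : IsLatticeFilter (⋃₀ c) := by
  refine ⟨?_, ?_, ?_⟩
  · rintro ⟨G, hG, hbot⟩
    exact (hc G hG).1 hbot
  · obtain ⟨G, hG⟩ := hne
    exact ⟨G, hG, (hc G hG).2.1⟩
  · rintro a ⟨G, hG, ha⟩ b ⟨H, hH, hb⟩ x hx
    rcases hchain.total hG hH with hGH | hHG
    · exact ⟨H, hH, (hc H hH).2.2 a (hGH ha) b hb x hx⟩
    · exact ⟨G, hG, (hc G hG).2.2 a ha b (hHG hb) x hx⟩

/-- Every filter extends to an ultrafilter. -/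
theorem IsLatticeFilter.exists_isUltraLatFilter_superset {L : Type*} [Lattice L] [BoundedOrder L]
    {F : Set L} (hF : IsLatticeFilter F) : ∃ G : Set L, F ⊆ G ∧ IsUltraLatFilter G := by
  obtain ⟨G, hFG, hG⟩ := zorn_subset_nonempty {G : Set L | IsLatticeFilter G}
    (fun _ hc hchain hne =>
      ⟨_, IsLatticeFilter.sUnion_of_isChain (fun _ hG => hc hG) hchain hne,
        fun _ hG => Set.subset_sUnion_of_mem hG⟩) F hF
  exact ⟨G, hFG, hG.prop, fun _ hH hGH => (hG.eq_of_subset hH hGH).symm⟩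

/-- The upward closure of the image of a filter under a homomorphism with trivial kernel
is a filter. -/
theorem IsLatticeFilter.upperClosure_image {K L : Type*} [Lattice K] [BoundedOrder K]
    [Lattice L] [BoundedOrder L] (h : BoundedLatticeHom K L) (hker : ∀ a : K, h a = ⊥ → a = ⊥)
    {F : Set K} (hF : IsLatticeFilter F) : IsLatticeFilter {x : L | ∃ a ∈ F, h a ≤ x} := by
  refine ⟨?_, ⟨⊤, hF.2.1, le_top⟩, ?_⟩
  · rintro ⟨a, ha, hle⟩
    exact hF.1 (hker a (le_bot_iff.mp hle) ▸ ha)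
  · rintro x ⟨a, ha, hax⟩ y ⟨b, hb, hby⟩ z hz
    refine ⟨a ⊓ b, hF.2.2 a ha b hb _ le_rfl, ?_⟩
    rw [map_inf]
    exact (inf_le_inf hax hby).trans hz

/-- If `h : K → L` is a bounded lattice homomorphism of normal bounded distributive
lattices with `h⁻¹({⊥}) = {⊥}`, then the induced map `Ult h : Ult L → Ult K`
(sending `p` to the unique ultrafilter extending `h⁻¹(p)`) is surjective. -/
theorem induced_map_surjective {K L : Type*}
    [DistribLattice K] [BoundedOrder K] [DistribLattice L] [BoundedOrder L]
    (hKn : IsNormalLat K) (hLn : IsNormalLat L)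
    (h : BoundedLatticeHom K L) (hker : ∀ a : K, h a = ⊥ → a = ⊥)
    (f : UltraFilterSpace L → UltraFilterSpace K)
    (hf : ∀ p : UltraFilterSpace L, ⇑h ⁻¹' p.1 ⊆ (f p).1) :
    Function.Surjective f := by
  intro q
  obtain ⟨p, hqp, hp⟩ :=
    (q.2.1.upperClosure_image h hker).exists_isUltraLatFilter_superset
  refine ⟨⟨p, hp⟩, Subtype.ext (q.2.2 _ (f ⟨p, hp⟩).2.1 ?_)⟩
  exact fun a ha => hf ⟨p, hp⟩ (hqp ⟨a, ha, le_rfl⟩)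
end

section
/- Let X be a compact Hausdorff space and let L be a basic lattice of closed subsets of X, i.e., a family of closed sets containing ∅ and X, closed under finite unions and finite intersections, such that every closed subset of X is an intersection of members of L. Then for every closed set a ⊆ X and every open set v with a ⊆ v there exists b ∈ L such that a ⊆ int(b) ⊆ b ⊆ v. -/
/-- A basic lattice for a topological space `X`: a family of closed sets containing
`∅` and `X`, closed under finite unions and intersections, such that every closed
subset of `X` is an intersection of members of the family. -/
def IsBasicLattice {X : Type*} [TopologicalSpace X] (L : Set (Set X)) : Prop :=
  (∀ a ∈ L, IsClosed a) ∧ (∅ : Set X) ∈ L ∧ Set.univ ∈ L ∧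
  (∀ a ∈ L, ∀ b ∈ L, a ∪ b ∈ L) ∧ (∀ a ∈ L, ∀ b ∈ L, a ∩ b ∈ L) ∧
  (∀ c : Set X, IsClosed c → ∃ S ⊆ L, c = ⋂₀ S)

/-- If `X` is compact Hausdorff and `L` is a basic lattice of closed subsets of `X`,
then for every closed set `a` and every neighbourhood `v` of `a` there is `b ∈ L`
with `a ⊆ int b ⊆ b ⊆ v`. -/
theorem basic_lattice_interpolation {X : Type*} [TopologicalSpace X]
    [CompactSpace X] [T2Space X] (L : Set (Set X)) (hL : IsBasicLattice L) :
    ∀ a : Set X, IsClosed a → ∀ v : Set X, IsOpen v → a ⊆ v →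
      ∃ b ∈ L, a ⊆ interior b ∧ b ⊆ v := by
  intro a ha v hv hav
  obtain ⟨hclosed, -, huniv, -, hinter, hbase⟩ := hL
  obtain ⟨u, hu, hau, huv⟩ := normal_exists_closure_subset ha hv hav
  obtain ⟨S, hSL, hS⟩ := hbase (closure u) isClosed_closure
  have hempty : vᶜ ∩ ⋂ i : S, (i : Set X) = ∅ := by
    rw [← Set.sInter_eq_iInter, ← hS, ← Set.disjoint_iff_inter_eq_empty]
    exact Set.disjoint_compl_left_iff_subset.mpr huv
  obtain ⟨T, hT⟩ := hv.isClosed_compl.isCompact.elim_finite_subfamily_closed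
    (fun i : S ↦ (i : Set X)) (fun i ↦ hclosed i (hSL i.2)) hempty
  refine ⟨⋂ i ∈ T, (i : Set X), ?_, ?_, ?_⟩
  · rw [← Finset.inf_set_eq_iInter]
    exact Finset.inf_induction huniv hinter fun i _ ↦ hSL i.2
  · refine hau.trans (interior_maximal (Set.subset_iInter₂ fun i _ ↦ ?_) hu)
    exact subset_closure.trans (hS ▸ Set.sInter_subset_of_mem i.2)
  · exact Set.disjoint_compl_left_iff_subset.mp (Set.disjoint_iff_inter_eq_empty.mpr hT)
end

section
/- Let X be a compact Hausdorff space and let L be a family of closed subsets of X containing ∅ and X, closed under finite unions and finite intersections, whose complements form a subbase for the topology of X (i.e., L is a closed subbase). Then: (1) L, ordered by inclusion, is a normal and separative bounded distributive lattice; and (2) the map sending x ∈ X to {a ∈ L : x ∈ a} is a homeomorphism of X onto Ult L, the space of ultrafilters of L with the Wallman topology. -/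
/-- A filter in a lattice `L` of subsets of `X` (ordered by inclusion, with
`⊥ = ∅` and `⊤ = univ`): a subfamily `F ⊆ L` with `∅ ∉ F`, `univ ∈ F`, closed
upwards (within `L`) under finite intersections. -/
def IsFilterIn {X : Type*} (L F : Set (Set X)) : Prop :=
  F ⊆ L ∧ (∅ : Set X) ∉ F ∧ Set.univ ∈ F ∧
    ∀ a ∈ F, ∀ b ∈ F, ∀ x ∈ L, a ∩ b ⊆ x → x ∈ F

/-- An ultrafilter in a lattice `L` of subsets of `X`: a maximal filter. -/
def IsUltraIn {X : Type*} (L F : Set (Set X)) : Prop :=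
  IsFilterIn L F ∧ ∀ G : Set (Set X), IsFilterIn L G → F ⊆ G → G = F

/-- `Ult L`: the set of ultrafilters of the set-lattice `L`. -/
abbrev UltIn {X : Type*} (L : Set (Set X)) := {F : Set (Set X) // IsUltraIn L F}

/-- The Wallman topology on `Ult L`, generated by the sets `a⁻ = {p : a ∉ p}`. -/
instance {X : Type*} (L : Set (Set X)) : TopologicalSpace (UltIn L) :=
  TopologicalSpace.generateFrom {S : Set (UltIn L) | ∃ a ∈ L, S = {p : UltIn L | a ∉ p.1}}

open Set TopologicalSpace

section

variable {X : Type*}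

/-- If the complements of members of `L` generate the topology and `L` is closed under finite
unions, then a point outside a closed set `C` is outside some member of `L` containing `C`. -/
lemma exists_mem_superset_notMem_of_isClosed [tX : TopologicalSpace X] {L : Set (Set X)}
    (hempty : (∅ : Set X) ∈ L) (hunion : ∀ a ∈ L, ∀ b ∈ L, a ∪ b ∈ L)
    (hsubbase : tX = generateFrom {u : Set X | ∃ a ∈ L, u = aᶜ})
    {C : Set X} (hC : IsClosed C) {x : X} (hx : x ∉ C) :
    ∃ a ∈ L, C ⊆ a ∧ x ∉ a := by
  have hfin : FiniteInter {u : Set X | ∃ a ∈ L, u = aᶜ} := by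
    refine ⟨⟨∅, hempty, compl_empty.symm⟩, ?_⟩
    rintro _ ⟨a, ha, rfl⟩ _ ⟨b, hb, rfl⟩
    exact ⟨a ∪ b, hunion a ha b hb, (compl_union a b).symm⟩
  obtain ⟨_, ⟨a, ha, rfl⟩, hxa, haC⟩ :=
    (isTopologicalBasis_of_subbasis_of_finiteInter hsubbase hfin).exists_subset_of_mem_open
      (show x ∈ Cᶜ from hx) hC.isOpen_compl
  exact ⟨a, ha, compl_subset_compl.mp haC, hxa⟩

/-- In a compact space, a closed subbase that is closed under finite unions and intersections
interpolates between a closed set and an open set containing it. -/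
lemma exists_mem_between_of_isClosed_isOpen [tX : TopologicalSpace X] [CompactSpace X]
    {L : Set (Set X)} (hclosed : ∀ a ∈ L, IsClosed a)
    (hempty : (∅ : Set X) ∈ L) (huniv : univ ∈ L)
    (hunion : ∀ a ∈ L, ∀ b ∈ L, a ∪ b ∈ L) (hinter : ∀ a ∈ L, ∀ b ∈ L, a ∩ b ∈ L)
    (hsubbase : tX = generateFrom {u : Set X | ∃ a ∈ L, u = aᶜ})
    {C U : Set X} (hC : IsClosed C) (hU : IsOpen U) (hCU : C ⊆ U) :
    ∃ a ∈ L, C ⊆ a ∧ a ⊆ U := by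
  have : Nonempty {a : Set X // a ∈ L ∧ C ⊆ a} := ⟨⟨univ, huniv, subset_univ C⟩⟩
  obtain ⟨⟨a, haL, hCa⟩, haU⟩ := exists_subset_nhds_of_compactSpace
    (V := fun a : {a : Set X // a ∈ L ∧ C ⊆ a} ↦ a.1) (U := U)
    (fun a b ↦ ⟨⟨a.1 ∩ b.1, hinter _ a.2.1 _ b.2.1, subset_inter a.2.2 b.2.2⟩,
      inter_subset_left, inter_subset_right⟩)
    (fun a ↦ hclosed _ a.2.1) fun x hx ↦ by
      refine hU.mem_nhds (hCU ?_)
      by_contra hxC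
      obtain ⟨a, haL, hCa, hxa⟩ :=
        exists_mem_superset_notMem_of_isClosed hempty hunion hsubbase hC hxC
      exact hxa (mem_iInter.mp hx ⟨a, haL, hCa⟩)
  exact ⟨a, haL, hCa, haU⟩

/-- The members of `L` containing a given point form a filter. -/
lemma isFilterIn_setOf_mem {L : Set (Set X)} (huniv : univ ∈ L) (x : X) :
    IsFilterIn L {a ∈ L | x ∈ a} :=
  ⟨fun _ ha ↦ ha.1, fun h ↦ h.2, ⟨huniv, mem_univ x⟩,
    fun _ ha _ hb _ hc h ↦ ⟨hc, h ⟨ha.2, hb.2⟩⟩⟩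

/-- If every point outside a member of `L` lies in a member of `L` disjoint from it, then the
members of `L` containing a given point form an ultrafilter. -/
lemma isUltraIn_setOf_mem {L : Set (Set X)} (hempty : (∅ : Set X) ∈ L) (huniv : univ ∈ L)
    (hsep : ∀ a ∈ L, ∀ x ∉ a, ∃ c ∈ L, x ∈ c ∧ c ⊆ aᶜ) (x : X) :
    IsUltraIn L {a ∈ L | x ∈ a} := by
  refine ⟨isFilterIn_setOf_mem huniv x, fun G hG hxG ↦ Subset.antisymm (fun a ha ↦ ?_) hxG⟩
  refine ⟨hG.1 ha, ?_⟩
  by_contra hxa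
  obtain ⟨c, hcL, hxc, hca⟩ := hsep a (hG.1 ha) x hxa
  exact hG.2.1 (hG.2.2.2 c (hxG ⟨hcL, hxc⟩) a ha ∅ hempty fun y hy ↦ hca hy.1 hy.2)

/-- In a compact space, a filter in a lattice of closed sets has a common point. -/
lemma IsFilterIn.nonempty_sInter [TopologicalSpace X] [CompactSpace X] {L F : Set (Set X)}
    (hF : IsFilterIn L F) (hclosed : ∀ a ∈ L, IsClosed a)
    (hinter : ∀ a ∈ L, ∀ b ∈ L, a ∩ b ∈ L) : (⋂₀ F).Nonempty := by
  obtain ⟨hFL, hF_empty, hF_univ, hF_inter⟩ := hF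
  have : Nonempty F := ⟨⟨univ, hF_univ⟩⟩
  refine IsCompact.nonempty_sInter_of_directed_nonempty_isCompact_isClosed ?_ ?_ ?_ ?_
  · exact fun a ha b hb ↦ ⟨a ∩ b,
      hF_inter a ha b hb _ (hinter a (hFL ha) b (hFL hb)) Subset.rfl,
      inter_subset_left, inter_subset_right⟩
  · exact fun a ha ↦ nonempty_iff_ne_empty.mpr fun h ↦ hF_empty (h ▸ ha)
  · exact fun a ha ↦ (hclosed a (hFL ha)).isCompact
  · exact fun a ha ↦ hclosed a (hFL ha)

end

/-- Let `X` be compact Hausdorff and let `L` be a sublattice of closed subsets of `X`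
(containing `∅` and `X`) which is a closed subbase (the complements of members of `L`
generate the topology). Then `L` is a normal and separative lattice, and
`x ↦ {a ∈ L : x ∈ a}` is a homeomorphism of `X` onto `Ult L`. -/
theorem closed_subbase_normal_separative_homeo {X : Type*}
    [tX : TopologicalSpace X] [CompactSpace X] [T2Space X]
    (L : Set (Set X))
    (hclosed : ∀ a ∈ L, IsClosed a)
    (hempty : (∅ : Set X) ∈ L) (huniv : Set.univ ∈ L)
    (hunion : ∀ a ∈ L, ∀ b ∈ L, a ∪ b ∈ L)
    (hinter : ∀ a ∈ L, ∀ b ∈ L, a ∩ b ∈ L)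
    (hsubbase : tX = TopologicalSpace.generateFrom {u : Set X | ∃ a ∈ L, u = aᶜ}) :
    ((∀ a ∈ L, ∀ b ∈ L, a ∩ b = ∅ →
        ∃ a₁ ∈ L, ∃ b₁ ∈ L, a₁ ∩ b = ∅ ∧ a ∩ b₁ = ∅ ∧ a₁ ∪ b₁ = Set.univ) ∧
      (∀ a ∈ L, ∀ b ∈ L, a.Nonempty → ¬a ⊆ b →
        ∃ c ∈ L, c.Nonempty ∧ c ⊆ a ∧ c ∩ b = ∅)) ∧
    ∃ e : X ≃ₜ UltIn L, ∀ x : X, (e x).1 = {a ∈ L | x ∈ a} := by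
  have hbetween {C U : Set X} (hC : IsClosed C) (hU : IsOpen U) (hCU : C ⊆ U) :
      ∃ a ∈ L, C ⊆ a ∧ a ⊆ U :=
    exists_mem_between_of_isClosed_isOpen hclosed hempty huniv hunion hinter hsubbase hC hU hCU
  have hsep : ∀ a ∈ L, ∀ x ∉ a, ∃ c ∈ L, x ∈ c ∧ c ⊆ aᶜ := fun a ha x hxa ↦ by
    simpa using hbetween isClosed_singleton (hclosed a ha).isOpen_compl
      (singleton_subset_iff.mpr hxa)
  refine ⟨⟨fun a ha b hb hab ↦ ?_, fun a ha b hb _ hab ↦ ?_⟩, ?_⟩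
  · obtain ⟨U, V, hU, hV, haU, hbV, hUV⟩ :=
      normal_separation (hclosed a ha) (hclosed b hb) (disjoint_iff_inter_eq_empty.mpr hab)
    obtain ⟨a₁, ha₁, hVa₁, ha₁b⟩ := hbetween hV.isClosed_compl (hclosed b hb).isOpen_compl
      (compl_subset_compl.mpr hbV)
    obtain ⟨b₁, hb₁, hUb₁, hb₁a⟩ := hbetween hU.isClosed_compl (hclosed a ha).isOpen_compl
      (compl_subset_compl.mpr haU)
    refine ⟨a₁, ha₁, b₁, hb₁, ?_, ?_, ?_⟩
    · exact disjoint_iff_inter_eq_empty.mp (subset_compl_iff_disjoint_right.mp ha₁b)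
    · exact disjoint_iff_inter_eq_empty.mp (subset_compl_iff_disjoint_left.mp hb₁a)
    · refine univ_subset_iff.mp (Subset.trans ?_ (union_subset_union hVa₁ hUb₁))
      rw [← compl_inter, hUV.symm.inter_eq, compl_empty]
  · obtain ⟨x, hxa, hxb⟩ := not_subset.mp hab
    obtain ⟨c, hc, hxc, hcb⟩ := hsep b hb x hxb
    exact ⟨c ∩ a, hinter c hc a ha, ⟨x, hxc, hxa⟩, inter_subset_right,
      disjoint_iff_inter_eq_empty.mp
        (subset_compl_iff_disjoint_right.mp (inter_subset_left.trans hcb))⟩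
  · let f : X → UltIn L := fun x ↦ ⟨{a ∈ L | x ∈ a}, isUltraIn_setOf_mem hempty huniv hsep x⟩
    have hf_inj : Function.Injective f := fun x y hxy ↦ by
      by_contra hne
      obtain ⟨a, ha, hya, hxa⟩ := exists_mem_superset_notMem_of_isClosed hempty hunion hsubbase
        (isClosed_singleton (x := y)) hne
      have hay : a ∈ (f y).1 := ⟨ha, hya rfl⟩
      rw [← hxy] at hay
      exact hxa hay.2
    have hf_surj : Function.Surjective f := fun p ↦ by
      obtain ⟨x, hx⟩ := p.2.1.nonempty_sInter hclosed hinter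
      exact ⟨x, Subtype.ext (p.2.2 _ (isFilterIn_setOf_mem huniv x)
        fun a ha ↦ ⟨p.2.1.1 ha, hx a ha⟩)⟩
    have hf_preimage {a : Set X} (ha : a ∈ L) : f ⁻¹' {p | a ∉ p.1} = aᶜ := by
      ext x
      simp [f, ha]
    have hf_ind : Topology.IsInducing f := by
      refine ⟨hsubbase.trans (Eq.trans (congrArg generateFrom ?_) induced_generateFrom_eq.symm)⟩
      ext u
      constructor
      · rintro ⟨a, ha, rfl⟩
        exact ⟨_, ⟨a, ha, rfl⟩, hf_preimage ha⟩
      · rintro ⟨_, ⟨a, ha, rfl⟩, rfl⟩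
        exact ⟨a, ha, hf_preimage ha⟩
    exact ⟨(Equiv.ofBijective f ⟨hf_inj, hf_surj⟩).toHomeomorphOfIsInducing hf_ind,
      fun _ ↦ rfl⟩
end

section
/- (Alexandrov) Every infinite compact Hausdorff space X is a continuous image of a compact Hausdorff zero-dimensional space of the same weight: there exist a compact Hausdorff space Y in which the clopen sets form an open base, and a continuous surjection f : Y → X, such that the weight of Y equals the weight of X. -/
universe u

/-- The weight of a topological space: the least cardinality of an open base. -/
noncomputable def tweight (X : Type*) [TopologicalSpace X] : Cardinal :=
  ⨅ B : {B : Set (Set X) // TopologicalSpace.IsTopologicalBasis B}, Cardinal.mk B.1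

open TopologicalSpace Cardinal

theorem tweight_le_mk {X : Type u} [TopologicalSpace X] {B : Set (Set X)}
    (hB : IsTopologicalBasis B) : tweight X ≤ #B :=
  ciInf_le' (fun B : {B : Set (Set X) // IsTopologicalBasis B} => #B.1) ⟨B, hB⟩

theorem exists_isTopologicalBasis_mk_eq_tweight (X : Type u) [TopologicalSpace X] :
    ∃ B : Set (Set X), IsTopologicalBasis B ∧ #B = tweight X := by
  have : Nonempty {B : Set (Set X) // IsTopologicalBasis B} := ⟨⟨_, isTopologicalBasis_opens⟩⟩
  obtain ⟨B, hB⟩ := ciInf_mem (fun B : {B : Set (Set X) // IsTopologicalBasis B} => #B.1)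
  exact ⟨B.1, B.2, hB⟩

theorem infinite_of_isTopologicalBasis {X : Type u} [TopologicalSpace X] [T0Space X] [Infinite X]
    {B : Set (Set X)} (hB : IsTopologicalBasis B) : Infinite B := by
  by_contra h
  rw [not_infinite_iff_finite] at h
  refine not_finite_iff_infinite.2 ‹Infinite X› (Finite.of_injective
    (fun x => {b : B | x ∈ b.1}) fun x y hxy => ?_)
  refine Inseparable.eq (hB.inseparable_iff.2 fun s hs => ?_)
  exact Set.ext_iff.1 hxy ⟨s, hs⟩

/-- If an open family indexed by the finite subsets of an infinite type is a base, then the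
cardinality of that type bounds the weight. -/
theorem tweight_le_of_finset_indexed {X ι : Type u} [TopologicalSpace X] [Infinite ι]
    {U : Finset ι → Set X} (hU : IsTopologicalBasis (Set.range U)) : tweight X ≤ #ι :=
  (tweight_le_mk hU).trans (mk_range_le.trans (mk_finset_of_infinite ι).le)

/-- A continuous surjection from a compact space onto an infinite Hausdorff space does not raise
the weight. -/
theorem tweight_le_of_surjective {X Y : Type u} [TopologicalSpace X] [TopologicalSpace Y]
    [CompactSpace Y] [T0Space Y] [T2Space X] [Infinite X] {f : Y → X} (hf : Continuous f)
    (hs : Function.Surjective f) : tweight X ≤ tweight Y := by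
  obtain ⟨C, hC, hCw⟩ := exists_isTopologicalBasis_mk_eq_tweight Y
  have : Infinite Y := Infinite.of_surjective f hs
  have : Infinite C := infinite_of_isTopologicalBasis hC
  rw [← hCw]
  let U : Finset C → Set X := fun F => (f '' (⋃ c ∈ F, c.1)ᶜ)ᶜ
  refine tweight_le_of_finset_indexed (U := U) (isTopologicalBasis_of_isOpen_of_nhds ?_ ?_)
  · rintro _ ⟨F, rfl⟩
    exact (hf.isClosedMap _ (isOpen_biUnion fun c _ => hC.isOpen c.2).isClosed_compl).isOpen_compl
  · intro x u hx hu
    have hK : IsCompact (f ⁻¹' {x}) := (isClosed_singleton.preimage hf).isCompact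
    obtain ⟨t, ht⟩ := hK.elim_finite_subcover
      (fun c : {c : C // c.1 ⊆ f ⁻¹' u} => c.1.1) (fun c => hC.isOpen c.1.2) fun y hy => by
        have hyu : y ∈ f ⁻¹' u := by
          rw [Set.mem_preimage, show f y = x from hy]
          exact hx
        obtain ⟨c, hc, hyc, hcu⟩ := hC.exists_subset_of_mem_open hyu (hu.preimage hf)
        exact Set.mem_iUnion.2 ⟨⟨⟨c, hc⟩, hcu⟩, hyc⟩
    refine ⟨_, ⟨t.map (Function.Embedding.subtype _), rfl⟩, ?_, fun z hz => ?_⟩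
    · rintro ⟨y, hy, hyx⟩
      obtain ⟨c, hct, hyc⟩ := Set.mem_iUnion₂.1 (ht hyx)
      exact hy (Set.mem_iUnion₂.2 ⟨c.1, Finset.mem_map_of_mem _ hct, hyc⟩)
    · obtain ⟨y, rfl⟩ := hs z
      by_contra hyu
      refine hz ⟨y, fun hy => ?_, rfl⟩
      obtain ⟨c, hc, hyc⟩ := Set.mem_iUnion₂.1 hy
      obtain ⟨d, -, rfl⟩ := Finset.mem_map.1 hc
      exact hyu (d.2 hyc)

/-- The weight of a subspace of a Cantor cube on infinitely many coordinates is at most the number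
of coordinates. -/
theorem tweight_le_of_isInducing {Y ι : Type u} [TopologicalSpace Y] [Infinite ι]
    {g : Y → ι → Bool} (hg : Topology.IsInducing g) : tweight Y ≤ #ι := by
  classical
  let U : Finset (ι × Bool) → Set Y := fun F => {y | ∀ p ∈ F, g y p.1 = p.2}
  have hU : IsTopologicalBasis (Set.range U) := by
    refine isTopologicalBasis_of_isOpen_of_nhds ?_ ?_
    · rintro _ ⟨F, rfl⟩
      have : U F = ⋂ p ∈ F, (fun y => g y p.1) ⁻¹' {p.2} := by
        ext y
        simp [U]
      rw [this]
      exact isOpen_biInter_finset fun p _ =>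
        (isOpen_discrete _).preimage ((continuous_apply p.1).comp hg.continuous)
    · intro a u ha hu
      obtain ⟨v, hv, rfl⟩ := hg.isOpen_iff.1 hu
      obtain ⟨I, w, hw, hIw⟩ := isOpen_pi_iff.1 hv (g a) ha
      refine ⟨_, ⟨I.image fun i => (i, g a i), rfl⟩, ?_, fun y hy => hIw fun i hi => ?_⟩
      · intro p hp
        obtain ⟨i, -, rfl⟩ := Finset.mem_image.1 hp
        rfl
      · rw [hy _ (Finset.mem_image_of_mem _ hi)]
        exact (hw i hi).2
  refine (tweight_le_of_finset_indexed hU).trans ?_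
  rw [mk_prod, lift_uzero]
  exact (mul_le_max_of_aleph0_le_left (aleph0_le_mk ι)).trans
    (max_le le_rfl ((lift_le_aleph0.2 mk_le_aleph0).trans (aleph0_le_mk ι)))

/-- The points of `X` together with a choice, for each `b ∈ B`, of one of the sets `closure b`
and `bᶜ` containing the point. -/
def signedPoints {X : Type u} [TopologicalSpace X] (B : Set (Set X)) : Set (X × (B → Bool)) :=
  {p | ∀ b : B, (p.2 b = true ∧ p.1 ∈ closure b.1) ∨ (p.2 b = false ∧ p.1 ∈ b.1ᶜ)}

theorem isClosed_signedPoints {X : Type u} [TopologicalSpace X] {B : Set (Set X)}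
    (hB : IsTopologicalBasis B) : IsClosed (signedPoints B) := by
  rw [signedPoints, Set.ofPred_forall]
  refine isClosed_iInter fun b => ?_
  have hb (e : Bool) : IsClosed {p : X × (B → Bool) | p.2 b = e} :=
    isClosed_eq ((continuous_apply b).comp continuous_snd) continuous_const
  exact ((hb true).inter (isClosed_closure.preimage continuous_fst)).union
    ((hb false).inter ((hB.isOpen b.2).isClosed_compl.preimage continuous_fst))

theorem surjective_fst_signedPoints {X : Type u} [TopologicalSpace X] (B : Set (Set X)) :
    Function.Surjective fun p : signedPoints B => p.1.1 := by
  classical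
  intro x
  refine ⟨⟨(x, fun b => decide (x ∈ b.1)), fun b => ?_⟩, rfl⟩
  by_cases hx : x ∈ b.1
  · exact Or.inl ⟨by simpa using hx, subset_closure hx⟩
  · exact Or.inr ⟨by simpa using hx, hx⟩

theorem injective_snd_signedPoints {X : Type u} [TopologicalSpace X] [T2Space X] [CompactSpace X]
    {B : Set (Set X)} (hB : IsTopologicalBasis B) :
    Function.Injective fun p : signedPoints B => p.1.2 := by
  rintro ⟨⟨x, s⟩, hx⟩ ⟨⟨y, t⟩, hy⟩ (rfl : s = t)
  suffices x = y by subst this; rfl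
  by_contra hxy
  obtain ⟨b, hb, hxb, hby⟩ := hB.exists_closure_subset (isOpen_compl_singleton.mem_nhds hxy)
  rcases hx ⟨b, hb⟩ with ⟨hs, -⟩ | ⟨-, h⟩
  · rcases hy ⟨b, hb⟩ with ⟨-, h⟩ | ⟨hs', -⟩
    · exact hby h rfl
    · exact Bool.false_ne_true (hs'.symm.trans hs)
  · exact h hxb

/-- (Alexandrov) Every infinite compact Hausdorff space is a continuous image of a
compact Hausdorff zero-dimensional space of the same weight. -/
theorem alexandrov_zero_dimensional_preimage (X : Type u) [TopologicalSpace X]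
    [CompactSpace X] [T2Space X] [Infinite X] :
    ∃ (Y : Type u) (tY : TopologicalSpace Y),
      @CompactSpace Y tY ∧ @T2Space Y tY ∧
      @TopologicalSpace.IsTopologicalBasis Y tY {s : Set Y | @IsClopen Y tY s} ∧
      @tweight Y tY = tweight X ∧
      ∃ f : Y → X, @Continuous Y X tY _ f ∧ Function.Surjective f := by
  obtain ⟨B, hB, hBw⟩ := exists_isTopologicalBasis_mk_eq_tweight X
  have : Infinite B := infinite_of_isTopologicalBasis hB
  have : CompactSpace (signedPoints B) :=
    isCompact_iff_compactSpace.1 (isClosed_signedPoints hB).isCompact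
  have hf : Continuous fun p : signedPoints B => p.1.1 := by fun_prop
  have hg : Topology.IsEmbedding fun p : signedPoints B => p.1.2 :=
    (Continuous.isClosedEmbedding (by fun_prop) (injective_snd_signedPoints hB)).isEmbedding
  have hs := surjective_fst_signedPoints B
  have : TotallyDisconnectedSpace (signedPoints B) :=
    ⟨hg.isTotallyDisconnected (isTotallyDisconnected_of_totallyDisconnectedSpace _)⟩
  exact ⟨signedPoints B, inferInstance, inferInstance, inferInstance,
    isTopologicalBasis_isClopen, le_antisymm (hBw ▸ tweight_le_of_isInducing hg.isInducing)
      (tweight_le_of_surjective hf hs), _, hf, hs⟩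
end

section
/- Let X be a zero-dimensional compact Hausdorff space. Then X admits a T₀-separating weakly σ-point-finite family of open Fσ subsets (Sokolov's characterization of Gul'ko compactness) if and only if X admits a T₀-separating weakly σ-point-finite family consisting of clopen subsets. -/
/-- A family of subsets is `T₀`-separating if any two distinct points are separated:
some member contains exactly one of them. -/
def T0Separating {X : Type*} (U : Set (Set X)) : Prop :=
  ∀ x y : X, x ≠ y → ∃ u ∈ U, Xor' (x ∈ u) (y ∈ u)

/-- A family `U` is weakly σ-point-finite if `U = ⋃ n, Uₙ` in such a way that for
every point `x`, `U` is the union of those `Uₙ` for which `ord(x, Uₙ)` is finite,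
i.e. every `v ∈ U` lies in some `Uₙ` with `{w ∈ Uₙ : x ∈ w}` finite. -/
def WeaklySigmaPointFinite {X : Type*} (U : Set (Set X)) : Prop :=
  ∃ u : ℕ → Set (Set X), U = ⋃ n, u n ∧
    ∀ x : X, ∀ v ∈ U, ∃ n, v ∈ u n ∧ {w | w ∈ u n ∧ x ∈ w}.Finite

/-- An open `Fσ` set: an open set which is a countable union of closed sets. -/
def IsOpenFSigma {X : Type*} [TopologicalSpace X] (s : Set X) : Prop :=
  IsOpen s ∧ ∃ c : ℕ → Set X, (∀ n, IsClosed (c n)) ∧ s = ⋃ n, c n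

/-- If the clopen sets form a basis, any compact subset of an open set is contained in a clopen
set that is contained in the open set. -/
theorem IsCompact.exists_isClopen_between {X : Type*} [TopologicalSpace X]
    (hzd : TopologicalSpace.IsTopologicalBasis {s : Set X | IsClopen s}) {k s : Set X}
    (hk : IsCompact k) (hs : IsOpen s) (hks : k ⊆ s) : ∃ c, IsClopen c ∧ k ⊆ c ∧ c ⊆ s := by
  refine hk.induction_on (p := fun t => ∃ c, IsClopen c ∧ t ⊆ c ∧ c ⊆ s)
    ⟨∅, isClopen_empty, subset_rfl, s.empty_subset⟩ ?_ ?_ ?_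
  · rintro a b hab ⟨c, hc, hbc, hcs⟩
    exact ⟨c, hc, hab.trans hbc, hcs⟩
  · rintro a b ⟨c, hc, hac, hcs⟩ ⟨d, hd, hbd, hds⟩
    exact ⟨c ∪ d, hc.union hd, Set.union_subset_union hac hbd, Set.union_subset hcs hds⟩
  · intro x hx
    obtain ⟨c, hc, hxc, hcs⟩ := hzd.exists_subset_of_mem_open (hks hx) hs
    exact ⟨c, mem_nhdsWithin_of_mem_nhds (hc.isOpen.mem_nhds hxc), c, hc, subset_rfl, hcs⟩

/-- In a zero-dimensional compact space, an open `Fσ` set is a countable union of clopen sets. -/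
theorem IsOpenFSigma.exists_eq_iUnion_isClopen {X : Type*} [TopologicalSpace X] [CompactSpace X]
    (hzd : TopologicalSpace.IsTopologicalBasis {s : Set X | IsClopen s}) {s : Set X}
    (hs : IsOpenFSigma s) : ∃ c : ℕ → Set X, (∀ n, IsClopen (c n)) ∧ s = ⋃ n, c n := by
  obtain ⟨ho, k, hk, hsk⟩ := hs
  have key (n : ℕ) : ∃ c, IsClopen c ∧ k n ⊆ c ∧ c ⊆ s :=
    (hk n).isCompact.exists_isClopen_between hzd ho (hsk ▸ Set.subset_iUnion k n)
  choose c hc hkc hcs using key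
  exact ⟨c, hc, (hsk.trans_subset (Set.iUnion_mono hkc)).antisymm (Set.iUnion_subset hcs)⟩

theorem IsClopen.isOpenFSigma {X : Type*} [TopologicalSpace X] {s : Set X} (hs : IsClopen s) :
    IsOpenFSigma s :=
  ⟨hs.isOpen, fun _ => s, fun _ => hs.isClosed, (Set.iUnion_const s).symm⟩

/-- Replacing each member of a `T₀`-separating family by countably many sets with that member as
their union gives a `T₀`-separating family. -/
theorem T0Separating.of_eq_iUnion {X : Type*} {U V : Set (Set X)} (hU : T0Separating U)
    (c : Set X → ℕ → Set X) (hc : ∀ v ∈ U, v = ⋃ k, c v k) (hV : ∀ v ∈ U, ∀ k, c v k ∈ V) :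
    T0Separating V := by
  intro x y hxy
  obtain ⟨v, hv, h⟩ := hU x y hxy
  have mem (z : X) : z ∈ v ↔ ∃ k, z ∈ c v k := by
    rw [← Set.mem_iUnion, ← hc v hv]
  rcases h with ⟨hx, hy⟩ | ⟨hy, hx⟩
  · obtain ⟨k, hk⟩ := (mem x).1 hx
    exact ⟨c v k, hV v hv k, .inl ⟨hk, fun h => hy ((mem y).2 ⟨k, h⟩)⟩⟩
  · obtain ⟨k, hk⟩ := (mem y).1 hy
    exact ⟨c v k, hV v hv k, .inr ⟨hk, fun h => hx ((mem x).2 ⟨k, h⟩)⟩⟩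

/-- Replacing each member of a weakly σ-point-finite family by countably many of its subsets gives
a weakly σ-point-finite family. -/
theorem WeaklySigmaPointFinite.iUnion_image {X : Type*} {U : Set (Set X)}
    (hU : WeaklySigmaPointFinite U) (c : Set X → ℕ → Set X) (hc : ∀ v ∈ U, ∀ k, c v k ⊆ v) :
    WeaklySigmaPointFinite (⋃ k, (c · k) '' U) := by
  obtain ⟨u, rfl, hfin⟩ := hU
  refine ⟨fun m => (c · m.unpair.2) '' u m.unpair.1, ?_, ?_⟩
  · simp only [Set.image_iUnion]
    rw [Set.iUnion_unpair fun n k => (c · k) '' u n, Set.iUnion_comm]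
  · intro x w hw
    obtain ⟨k, v, hv, rfl⟩ := Set.mem_iUnion.1 hw
    obtain ⟨n, hvn, hn⟩ := hfin x v hv
    refine ⟨Nat.pair n k, ?_⟩
    simp only [Nat.unpair_pair]
    refine ⟨Set.mem_image_of_mem _ hvn, (hn.image (c · k)).subset ?_⟩
    rintro _ ⟨⟨v', hv', rfl⟩, hx⟩
    exact ⟨v', ⟨hv', hc v' (Set.mem_iUnion_of_mem n hv') k hx⟩, rfl⟩

/-- A zero-dimensional compact Hausdorff space admits a `T₀`-separating weakly
σ-point-finite family of open `Fσ` sets (Sokolov's characterization of Gul'ko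
compactness) iff it admits such a family consisting of clopen sets. -/
theorem gulko_zero_dim_clopen_family (X : Type*) [TopologicalSpace X]
    [CompactSpace X] [T2Space X]
    (hzd : TopologicalSpace.IsTopologicalBasis {s : Set X | IsClopen s}) :
    (∃ U : Set (Set X), (∀ u ∈ U, IsOpenFSigma u) ∧
        T0Separating U ∧ WeaklySigmaPointFinite U) ↔
      (∃ U : Set (Set X), (∀ u ∈ U, IsClopen u) ∧
        T0Separating U ∧ WeaklySigmaPointFinite U) := by
  refine ⟨?_, fun ⟨U, hU, h⟩ => ⟨U, fun u hu => (hU u hu).isOpenFSigma, h⟩⟩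
  rintro ⟨U, hU, hsep, hfin⟩
  have key (v : Set X) : ∃ c : ℕ → Set X, v ∈ U → (∀ k, IsClopen (c k)) ∧ v = ⋃ k, c k := by
    by_cases hv : v ∈ U
    · obtain ⟨c, hc⟩ := (hU v hv).exists_eq_iUnion_isClopen hzd
      exact ⟨c, fun _ => hc⟩
    · exact ⟨fun _ => ∅, fun h => absurd h hv⟩
  choose c hc using key
  refine ⟨⋃ k, (c · k) '' U, ?_, hsep.of_eq_iUnion c (fun v hv => (hc v hv).2) ?_,
    hfin.iUnion_image c fun v hv k => ?_⟩
  · intro w hw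
    obtain ⟨k, v, hv, rfl⟩ := Set.mem_iUnion.1 hw
    exact (hc v hv).1 k
  · exact fun v hv k => Set.mem_iUnion_of_mem k (Set.mem_image_of_mem _ hv)
  · exact (Set.subset_iUnion (c v) k).trans (hc v hv).2.superset
end

section
/- Let B be a Boolean algebra and let Ult B be its Stone space (the set of ultrafilters of B with the topology generated by the clopen sets a⁺ = {p ∈ Ult B : a ∈ p}, a ∈ B). Then Ult B admits a T₀-separating weakly σ-point-finite family of clopen subsets (equivalently, Ult B is Gul'ko compact) if and only if there exist a set U ⊆ B generating B as a Boolean algebra and a function φ : U → 𝒫(ℕ) \ {∅} such that for every u ∈ U the following strict order > is well-founded on the set P(U, φ, u) of pairs (s, k) where s ⊆ U is a finite centered set and k ∈ ℕ: define (s, k) < (t, l) if and only if s ⊆ t, k < l, and for every m ∈ φ(u) with m < k there exists v ∈ t \ s with m ∈ φ(v); well-foundedness of > means there is no infinite <-increasing sequence (s₀,k₀) < (s₁,k₁) < ⋯ in P(U, φ, u). -/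
/-- The Stone space of a Boolean algebra `B`: the set of ultrafilters of `B`. -/
abbrev StoneSpace (B : Type*) [BooleanAlgebra B] := {F : Set B // IsUltraLatFilter F}

/-- The Stone topology, generated by the (clopen) sets `a⁺ = {p : a ∈ p}`. -/
instance (B : Type*) [BooleanAlgebra B] : TopologicalSpace (StoneSpace B) :=
  TopologicalSpace.generateFrom
    {S : Set (StoneSpace B) | ∃ a : B, S = {p : StoneSpace B | a ∈ p.1}}

namespace IsLatticeFilter

variable {L : Type*} [Lattice L] [BoundedOrder L] {F : Set L}

theorem mem_of_le_s18 (hF : IsLatticeFilter F) {a b : L} (ha : a ∈ F) (h : a ≤ b) : b ∈ F :=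
  hF.2.2 a ha a ha b (by simpa using h)

theorem inf_mem_s18 (hF : IsLatticeFilter F) {a b : L} (ha : a ∈ F) (hb : b ∈ F) : a ⊓ b ∈ F :=
  hF.2.2 a ha b hb _ le_rfl

theorem finset_inf_mem (hF : IsLatticeFilter F) (s : Finset L) (hs : (s : Set L) ⊆ F) :
    s.inf id ∈ F :=
  Finset.inf_induction hF.2.1 (fun _ ha _ hb => hF.inf_mem_s18 ha hb) fun _ hb => hs hb

/-- The upward closure of a filter base avoiding `⊥` is a filter. -/
theorem upperClosure {G : Set L} (hne : G.Nonempty) (hbot : ⊥ ∉ G)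
    (hdir : ∀ a ∈ G, ∀ b ∈ G, ∃ c ∈ G, c ≤ a ⊓ b) :
    IsLatticeFilter {x : L | ∃ a ∈ G, a ≤ x} := by
  refine ⟨?_, ?_, ?_⟩
  · rintro ⟨a, ha, hle⟩
    exact hbot (le_bot_iff.1 hle ▸ ha)
  · obtain ⟨a, ha⟩ := hne
    exact ⟨a, ha, le_top⟩
  · rintro x ⟨a, ha, hax⟩ y ⟨b, hb, hby⟩ z hz
    obtain ⟨c, hc, hle⟩ := hdir a ha b hb
    exact ⟨c, hc, hle.trans ((inf_le_inf hax hby).trans hz)⟩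

/-- Every filter extends to an ultrafilter. -/
theorem exists_isUltraLatFilter (hF : IsLatticeFilter F) :
    ∃ p : Set L, IsUltraLatFilter p ∧ F ⊆ p := by
  have hzorn : ∃ p, F ⊆ p ∧ Maximal (· ∈ {G : Set L | IsLatticeFilter G}) p := by
    refine zorn_subset_nonempty {G : Set L | IsLatticeFilter G} ?_ F hF
    intro c hc hchain hcne
    refine ⟨⋃₀ c, ⟨?_, ?_, ?_⟩, fun s hs => Set.subset_sUnion_of_mem hs⟩
    · rintro ⟨s, hs, hbot⟩
      exact (hc hs).1 hbot
    · obtain ⟨s, hs⟩ := hcne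
      exact ⟨s, hs, (hc hs).2.1⟩
    · rintro a ⟨s, hs, ha⟩ b ⟨t, ht, hb⟩ x hx
      rcases hchain.total hs ht with h | h
      · exact ⟨t, ht, (hc ht).2.2 a (h ha) b hb x hx⟩
      · exact ⟨s, hs, (hc hs).2.2 a ha b (h hb) x hx⟩
  obtain ⟨p, hFp, hp⟩ := hzorn
  exact ⟨p, ⟨hp.1, fun G hG hpG => (hp.2 hG hpG).antisymm hpG⟩, hFp⟩

end IsLatticeFilter

namespace StoneSpace

variable {B : Type*} [BooleanAlgebra B]

/-- Every filter base avoiding `⊥` is contained in an ultrafilter. -/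
theorem exists_subset {G : Set B} (hne : G.Nonempty) (hbot : ⊥ ∉ G)
    (hdir : ∀ a ∈ G, ∀ b ∈ G, ∃ c ∈ G, c ≤ a ⊓ b) : ∃ p : StoneSpace B, G ⊆ p.1 := by
  obtain ⟨p, hp, hGp⟩ :=
    (IsLatticeFilter.upperClosure hne hbot hdir).exists_isUltraLatFilter
  exact ⟨⟨p, hp⟩, fun a ha => hGp ⟨a, ha, le_rfl⟩⟩

theorem bot_notMem (p : StoneSpace B) : ⊥ ∉ p.1 := p.2.1.1

theorem top_mem (p : StoneSpace B) : ⊤ ∈ p.1 := p.2.1.2.1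

theorem inf_mem_iff (p : StoneSpace B) {a b : B} : a ⊓ b ∈ p.1 ↔ a ∈ p.1 ∧ b ∈ p.1 :=
  ⟨fun h => ⟨p.2.1.mem_of_le_s18 h inf_le_left, p.2.1.mem_of_le_s18 h inf_le_right⟩,
    fun h => p.2.1.inf_mem_s18 h.1 h.2⟩

theorem compl_mem_iff (p : StoneSpace B) {a : B} : aᶜ ∈ p.1 ↔ a ∉ p.1 := by
  refine ⟨fun h ha => p.bot_notMem ?_, fun ha => ?_⟩
  · simpa using p.2.1.inf_mem_s18 ha h
  · by_contra hc
    have hG : IsLatticeFilter {x : B | ∃ c ∈ (fun b => b ⊓ a) '' p.1, c ≤ x} := by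
      refine .upperClosure ⟨_, ⊤, p.top_mem, rfl⟩ ?_ ?_
      · rintro ⟨b, hb, hba⟩
        exact hc (p.2.1.mem_of_le_s18 hb (disjoint_iff.2 hba).le_compl_right)
      · rintro _ ⟨b, hb, rfl⟩ _ ⟨c, hc, rfl⟩
        exact ⟨_, ⟨b ⊓ c, p.2.1.inf_mem_s18 hb hc, rfl⟩, le_inf
          (inf_le_inf_right _ inf_le_left) (inf_le_inf_right _ inf_le_right)⟩
    have h := p.2.2 _ hG fun b hb => ⟨_, ⟨b, hb, rfl⟩, inf_le_left⟩
    exact ha (h ▸ ⟨_, ⟨⊤, p.top_mem, rfl⟩, inf_le_right⟩)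

theorem sup_mem_iff (p : StoneSpace B) {a b : B} : a ⊔ b ∈ p.1 ↔ a ∈ p.1 ∨ b ∈ p.1 := by
  have h := p.compl_mem_iff (a := a ⊔ b)
  rw [compl_sup, inf_mem_iff, compl_mem_iff, compl_mem_iff] at h
  tauto

/-- The basic clopen set of all ultrafilters containing `a`. -/
def basic (a : B) : Set (StoneSpace B) := {p | a ∈ p.1}

theorem mem_basic {a : B} {p : StoneSpace B} : p ∈ basic a ↔ a ∈ p.1 := Iff.rfl

theorem exists_mem {a : B} (ha : a ≠ ⊥) : ∃ p : StoneSpace B, a ∈ p.1 := by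
  obtain ⟨p, hp⟩ := exists_subset (G := {a}) ⟨a, rfl⟩ (fun h => ha h.symm) (by simp)
  exact ⟨p, hp rfl⟩

theorem le_of_basic_subset {a b : B} (h : basic a ⊆ basic b) : a ≤ b := by
  by_contra hle
  have hne : a ⊓ bᶜ ≠ ⊥ := fun h0 => hle (by simpa using (disjoint_iff.2 h0).le_compl_right)
  obtain ⟨p, hp⟩ := exists_mem hne
  rw [inf_mem_iff, compl_mem_iff] at hp
  exact hp.2 (h hp.1)

theorem basic_injective : Function.Injective (basic : B → Set (StoneSpace B)) :=
  fun _ _ h => (le_of_basic_subset h.le).antisymm (le_of_basic_subset h.ge)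

theorem isOpen_basic (a : B) : IsOpen (basic a) :=
  TopologicalSpace.isOpen_generateFrom_of_mem ⟨a, rfl⟩

theorem isClopen_basic (a : B) : IsClopen (basic a) := by
  refine ⟨⟨?_⟩, isOpen_basic a⟩
  convert isOpen_basic aᶜ using 1
  ext p
  simp [mem_basic, compl_mem_iff]

theorem exists_basic_subset {C : Set (StoneSpace B)} (hC : IsOpen C) {p : StoneSpace B}
    (hp : p ∈ C) : ∃ a ∈ p.1, basic a ⊆ C := by
  induction hC with
  | basic s hs =>
    obtain ⟨a, rfl⟩ := hs
    exact ⟨a, hp, subset_rfl⟩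
  | univ => exact ⟨⊤, p.top_mem, Set.subset_univ _⟩
  | inter s t _ _ hs ht =>
    obtain ⟨a, ha, has⟩ := hs hp.1
    obtain ⟨b, hb, hbt⟩ := ht hp.2
    refine ⟨a ⊓ b, p.2.1.inf_mem_s18 ha hb, fun q hq => ?_⟩
    rw [mem_basic, inf_mem_iff] at hq
    exact ⟨has hq.1, hbt hq.2⟩
  | sUnion S _ ih =>
    obtain ⟨s, hs, hps⟩ := hp
    obtain ⟨a, ha, has⟩ := ih s hs hps
    exact ⟨a, ha, has.trans (Set.subset_sUnion_of_mem hs)⟩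

/-- Every clopen subset of the Stone space is basic. -/
theorem exists_basic_eq {C : Set (StoneSpace B)} (hC : IsClopen C) : ∃ a : B, basic a = C := by
  by_cases h : ∃ a b : B, basic a ⊆ C ∧ basic b ⊆ Cᶜ ∧ a ⊔ b = ⊤
  · obtain ⟨a, b, ha, hb, hab⟩ := h
    refine ⟨a, ha.antisymm fun p hp => ?_⟩
    have hp' : a ⊔ b ∈ p.1 := hab ▸ p.top_mem
    exact (p.sup_mem_iff.1 hp').resolve_right fun hbp => hb hbp hp
  · exfalso
    have hbasic_bot : basic (⊥ : B) = ∅ := Set.eq_empty_of_forall_notMem fun p => p.bot_notMem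
    have hex : ∃ p : StoneSpace B,
        {x : B | ∃ a b : B, basic a ⊆ C ∧ basic b ⊆ Cᶜ ∧ (a ⊔ b)ᶜ = x} ⊆ p.1 := by
      refine exists_subset ⟨_, ⊥, ⊥, by simp [hbasic_bot], by simp [hbasic_bot], rfl⟩ ?_ ?_
      · rintro ⟨a, b, ha, hb, hab⟩
        exact h ⟨a, b, ha, hb, compl_eq_bot.1 hab⟩
      · have hsup : ∀ {D : Set (StoneSpace B)} {a b : B}, basic a ⊆ D → basic b ⊆ D →
            basic (a ⊔ b) ⊆ D := fun ha hb q hq =>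
          (q.sup_mem_iff.1 hq).elim (fun h => ha h) fun h => hb h
        rintro _ ⟨a, b, ha, hb, rfl⟩ _ ⟨c, d, hc, hd, rfl⟩
        refine ⟨_, ⟨a ⊔ c, b ⊔ d, hsup ha hc, hsup hb hd, rfl⟩, ?_⟩
        rw [← compl_sup, sup_sup_sup_comm]
    obtain ⟨p, hp⟩ := hex
    by_cases hpC : p ∈ C
    · obtain ⟨a, ha, haC⟩ := exists_basic_subset hC.isOpen hpC
      have := hp ⟨a, ⊥, haC, by simp [hbasic_bot], rfl⟩
      rw [compl_mem_iff, sup_mem_iff] at this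
      exact this (.inl ha)
    · obtain ⟨b, hb, hbC⟩ := exists_basic_subset hC.compl.isOpen hpC
      have := hp ⟨⊥, b, by simp [hbasic_bot], hbC, rfl⟩
      rw [compl_mem_iff, sup_mem_iff] at this
      exact this (.inr hb)

/-- A subalgebra whose elements distinguish all ultrafilters is the whole algebra. -/
theorem mem_of_separating {S : Set B} (hbot : ⊥ ∈ S) (htop : ⊤ ∈ S)
    (hinf : ∀ a ∈ S, ∀ b ∈ S, a ⊓ b ∈ S) (hsup : ∀ a ∈ S, ∀ b ∈ S, a ⊔ b ∈ S)
    (hcompl : ∀ a ∈ S, aᶜ ∈ S)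
    (hsep : ∀ p q : StoneSpace B, (∀ a ∈ S, a ∈ p.1 ↔ a ∈ q.1) → p = q) (x : B) : x ∈ S := by
  by_contra hx
  have hexp : ∃ p : StoneSpace B, {y : B | ∃ s ∈ S, s ≤ x ∧ x ⊓ sᶜ = y} ⊆ p.1 := by
    refine exists_subset ⟨_, ⊥, hbot, bot_le, rfl⟩ ?_ ?_
    · rintro ⟨s, hs, hsx, h0⟩
      have hxs : x ≤ s := by simpa using (disjoint_iff.2 h0).le_compl_right
      exact hx (hsx.antisymm hxs ▸ hs)
    · rintro _ ⟨s, hs, hsx, rfl⟩ _ ⟨t, ht, htx, rfl⟩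
      exact ⟨_, ⟨s ⊔ t, hsup s hs t ht, sup_le hsx htx, rfl⟩,
        le_inf (inf_le_inf_left _ (compl_le_compl le_sup_left))
          (inf_le_inf_left _ (compl_le_compl le_sup_right))⟩
  obtain ⟨p, hp⟩ := hexp
  have hexq : ∃ q : StoneSpace B, {y : B | ∃ t ∈ S, t ∈ p.1 ∧ t ⊓ xᶜ = y} ⊆ q.1 := by
    refine exists_subset ⟨_, ⊤, htop, p.top_mem, rfl⟩ ?_ ?_
    · rintro ⟨t, ht, htp, h0⟩
      have htx : t ≤ x := by simpa using (disjoint_iff.2 h0).le_compl_right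
      exact p.compl_mem_iff.1 (p.inf_mem_iff.1 (hp ⟨t, ht, htx, rfl⟩)).2 htp
    · rintro _ ⟨s, hs, hsp, rfl⟩ _ ⟨t, ht, htp, rfl⟩
      exact ⟨_, ⟨s ⊓ t, hinf s hs t ht, p.2.1.inf_mem_s18 hsp htp, rfl⟩,
        le_inf (inf_le_inf_right _ inf_le_left) (inf_le_inf_right _ inf_le_right)⟩
  obtain ⟨q, hq⟩ := hexq
  have hxp : x ∈ p.1 := by simpa using hp ⟨⊥, hbot, bot_le, rfl⟩
  have hxq : xᶜ ∈ q.1 := by simpa using hq ⟨⊤, htop, p.top_mem, rfl⟩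
  have hpq : ∀ t ∈ S, t ∈ p.1 → t ∈ q.1 := fun t ht htp =>
    (q.inf_mem_iff.1 (hq ⟨t, ht, htp, rfl⟩)).1
  have heq : p = q := hsep p q fun a ha => ⟨hpq a ha, fun haq => by
    by_contra hap
    exact q.compl_mem_iff.1 (hpq _ (hcompl a ha) (p.compl_mem_iff.2 hap)) haq⟩
  exact q.compl_mem_iff.1 hxq (heq ▸ hxp)

/-- Ultrafilters are determined by their members in a generating set. -/
theorem eq_of_forall_mem_generators {U : Set B}
    (hgen : ∀ S : Set B, U ⊆ S → (⊥ : B) ∈ S → (⊤ : B) ∈ S →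
      (∀ a ∈ S, ∀ b ∈ S, a ⊓ b ∈ S) → (∀ a ∈ S, ∀ b ∈ S, a ⊔ b ∈ S) →
      (∀ a ∈ S, aᶜ ∈ S) → ∀ x : B, x ∈ S)
    {p q : StoneSpace B} (h : ∀ a ∈ U, a ∈ p.1 ↔ a ∈ q.1) : p = q := by
  refine Subtype.ext (Set.ext (hgen {a | a ∈ p.1 ↔ a ∈ q.1} h ?_ ?_ ?_ ?_ ?_))
  · exact iff_of_false p.bot_notMem q.bot_notMem
  · exact iff_of_true p.top_mem q.top_mem
  · intro a ha b hb
    simp only [Set.mem_ofPred_eq, inf_mem_iff] at ha hb ⊢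
    rw [ha, hb]
  · intro a ha b hb
    simp only [Set.mem_ofPred_eq, sup_mem_iff] at ha hb ⊢
    rw [ha, hb]
  · intro a ha
    simp only [Set.mem_ofPred_eq, compl_mem_iff] at ha ⊢
    rw [ha]

/-- Along an increasing sequence of centered pairs, some ultrafilter contains infinitely many
members of colour `m`, for each `m ∈ A`. -/
theorem exists_infinite_of_chain {φ : B → Set ℕ} {A : Set ℕ} {g : ℕ → Finset B × ℕ}
    (hcent : ∀ n, (g n).1.inf id ≠ ⊥)
    (hg : ∀ n : ℕ, (g n).1 ⊆ (g (n + 1)).1 ∧ (g n).2 < (g (n + 1)).2 ∧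
      ∀ m ∈ A, m < (g n).2 → ∃ v ∈ (g (n + 1)).1, v ∉ (g n).1 ∧ m ∈ φ v) :
    ∃ p : StoneSpace B, ∀ m ∈ A, {v | (∃ n, v ∈ (g n).1) ∧ v ∈ p.1 ∧ m ∈ φ v}.Infinite := by
  have hmono : Monotone fun n => (g n).1 := monotone_nat_of_le_succ fun n => (hg n).1
  have hk : StrictMono fun n => (g n).2 := strictMono_nat_of_lt_succ fun n => (hg n).2.1
  obtain ⟨p, hp⟩ := exists_subset (G := Set.range fun n => (g n).1.inf id)
    (Set.range_nonempty _) (fun ⟨n, hn⟩ => hcent n hn) (by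
      rintro _ ⟨i, rfl⟩ _ ⟨j, rfl⟩
      exact ⟨_, ⟨max i j, rfl⟩, le_inf (Finset.inf_mono (hmono (le_max_left i j)))
        (Finset.inf_mono (hmono (le_max_right i j)))⟩)
  have hmem : ∀ n, ∀ v ∈ (g n).1, v ∈ p.1 := fun n v hv =>
    p.2.1.mem_of_le_s18 (hp ⟨n, rfl⟩) (Finset.inf_le (f := id) hv)
  refine ⟨p, fun m hm => ?_⟩
  have hlt : ∀ n, m < (g (m + 1 + n)).2 := fun n => by
    have := hk.id_le (m + 1 + n)
    simp only [id] at this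
    omega
  choose v hv hvn hmv using fun n => (hg (m + 1 + n)).2.2 m hm (hlt n)
  have hinj : Function.Injective v := by
    refine Function.injective_iff_pairwise_ne.2 (.of_lt ?_)
    intro i j hij heq
    refine hvn j (heq ▸ hmono (show m + 1 + i + 1 ≤ m + 1 + j by omega) (hv i))
  exact (Set.infinite_range_of_injective hinj).mono
    (Set.range_subset_iff.2 fun n => ⟨⟨_, hv n⟩, hmem _ _ (hv n), hmv n⟩)

/-- If an ultrafilter contains infinitely many members of `U` of each colour in `A`, there is an
infinite increasing sequence of centered pairs. -/
theorem exists_chain_of_infinite {U : Set B} {φ : B → Set ℕ} {A : Set ℕ} (p : StoneSpace B)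
    (hinf : ∀ m ∈ A, {v | v ∈ U ∧ v ∈ p.1 ∧ m ∈ φ v}.Infinite) :
    ∃ g : ℕ → Finset B × ℕ,
      (∀ n : ℕ, ((g n).1 : Set B) ⊆ U ∧ (g n).1.inf id ≠ ⊥) ∧
      ∀ n : ℕ, (g n).1 ⊆ (g (n + 1)).1 ∧ (g n).2 < (g (n + 1)).2 ∧
        ∀ m ∈ A, m < (g n).2 → ∃ v ∈ (g (n + 1)).1, v ∉ (g n).1 ∧ m ∈ φ v := by
  classical
  have hpick : ∀ (s : Finset B) (m : ℕ), ∃ v, m ∈ A → (v ∈ U ∧ v ∈ p.1 ∧ m ∈ φ v) ∧ v ∉ s :=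
    fun s m => by
      by_cases hm : m ∈ A
      · obtain ⟨v, hv, hvs⟩ := (hinf m hm).exists_notMem_finset s
        exact ⟨v, fun _ => ⟨hv, hvs⟩⟩
      · exact ⟨⊥, fun h => absurd h hm⟩
  choose pick hpick using hpick
  let s : ℕ → Finset B := fun n =>
    Nat.rec ∅ (fun k t => t ∪ ((Finset.range k).filter (· ∈ A)).image (pick t)) n
  have hs : ∀ n, s (n + 1) = s n ∪ ((Finset.range n).filter (· ∈ A)).image (pick (s n)) :=
    fun _ => rfl
  have hsub : ∀ n, ∀ v ∈ s n, v ∈ U ∧ v ∈ p.1 := by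
    intro n
    induction n with
    | zero => exact fun v hv => absurd hv (Finset.notMem_empty v)
    | succ n ih =>
      intro v hv
      rw [hs, Finset.mem_union, Finset.mem_image] at hv
      rcases hv with hv | ⟨m, hm, rfl⟩
      · exact ih v hv
      · have h := (hpick (s n) m (Finset.mem_filter.1 hm).2).1
        exact ⟨h.1, h.2.1⟩
  refine ⟨fun n => (s n, n), fun n => ⟨fun v hv => (hsub n v hv).1, fun h => ?_⟩, fun n =>
    ⟨Finset.subset_union_left.trans (hs n).ge, n.lt_succ_self, fun m hm hmn => ?_⟩⟩
  · exact p.bot_notMem (h ▸ p.2.1.finset_inf_mem _ fun v hv => (hsub n v hv).2)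
  · have h := hpick (s n) m hm
    refine ⟨pick (s n) m, ?_, h.2, h.1.2.2⟩
    change pick (s n) m ∈ s (n + 1)
    rw [hs]
    exact Finset.mem_union_right _ (Finset.mem_image_of_mem _ (by simpa [hm] using hmn))

end StoneSpace

/-- The Stone space of a Boolean algebra `B` admits a `T₀`-separating weakly
σ-point-finite family of clopen sets (i.e. is Gul'ko compact) iff `B` is generated,
as a Boolean algebra, by a set `U` carrying a function `φ : U → 𝒫(ℕ) \ {∅}` such that
for every `u ∈ U` there is no infinite `<`-increasing sequence of pairs `(s, k)`,
`s ⊆ U` finite centered and `k ∈ ℕ`, where `(s,k) < (t,l)` iff `s ⊆ t`, `k < l`, and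
for every `m ∈ φ(u)` with `m < k` there is `v ∈ t \ s` with `m ∈ φ(v)`. -/
theorem stoneSpace_gulko_iff_wellFounded (B : Type*) [BooleanAlgebra B] :
    (∃ W : Set (Set (StoneSpace B)), (∀ w ∈ W, IsClopen w) ∧
        T0Separating W ∧ WeaklySigmaPointFinite W) ↔
      ∃ (U : Set B) (φ : B → Set ℕ),
        (∀ S : Set B, U ⊆ S → (⊥ : B) ∈ S → (⊤ : B) ∈ S →
          (∀ a ∈ S, ∀ b ∈ S, a ⊓ b ∈ S) → (∀ a ∈ S, ∀ b ∈ S, a ⊔ b ∈ S) →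
          (∀ a ∈ S, aᶜ ∈ S) → ∀ x : B, x ∈ S) ∧
        (∀ u ∈ U, (φ u).Nonempty) ∧
        ∀ u ∈ U,
          ¬∃ g : ℕ → Finset B × ℕ,
            (∀ n : ℕ, ((g n).1 : Set B) ⊆ U ∧ (g n).1.inf id ≠ ⊥) ∧
            ∀ n : ℕ, (g n).1 ⊆ (g (n + 1)).1 ∧ (g n).2 < (g (n + 1)).2 ∧
              ∀ m ∈ φ u, m < (g n).2 →
                ∃ v ∈ (g (n + 1)).1, v ∉ (g n).1 ∧ m ∈ φ v := by
  constructor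
  · rintro ⟨W, hclopen, hsep, u, hu, hfin⟩
    refine ⟨{a | StoneSpace.basic a ∈ W}, fun a => {n | StoneSpace.basic a ∈ u n}, ?_, ?_, ?_⟩
    · intro S hUS hbot htop hinf hsup hcompl
      refine StoneSpace.mem_of_separating hbot htop hinf hsup hcompl fun p q h => ?_
      by_contra hpq
      obtain ⟨w, hw, hxor⟩ := hsep p q hpq
      obtain ⟨a, rfl⟩ := StoneSpace.exists_basic_eq (hclopen w hw)
      have := h a (hUS hw)
      rw [StoneSpace.mem_basic, StoneSpace.mem_basic] at hxor
      rcases hxor with hxor | hxor <;> tauto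
    · intro a ha
      rw [Set.mem_ofPred_eq, hu] at ha
      exact Set.mem_iUnion.1 ha
    · rintro a ha ⟨g, hgU, hg⟩
      obtain ⟨p, hp⟩ := StoneSpace.exists_infinite_of_chain (fun n => (hgU n).2) hg
      obtain ⟨m, ham, hm⟩ := hfin p _ ha
      refine hp m ham ((hm.preimage StoneSpace.basic_injective.injOn).subset ?_)
      exact fun v hv => ⟨hv.2.2, hv.2.1⟩
  · rintro ⟨U, φ, hgen, hne, hwf⟩
    refine ⟨StoneSpace.basic '' U, ?_, ?_, fun n => StoneSpace.basic '' {a ∈ U | n ∈ φ a}, ?_, ?_⟩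
    · rintro _ ⟨a, -, rfl⟩
      exact StoneSpace.isClopen_basic a
    · intro p q hpq
      by_contra! h
      refine hpq (StoneSpace.eq_of_forall_mem_generators hgen fun a ha => ?_)
      exact not_xor _ _ |>.1 (h _ ⟨a, ha, rfl⟩)
    · rw [← Set.image_iUnion]
      congr 1
      ext a
      simp only [Set.mem_iUnion, Set.mem_ofPred_eq, exists_and_left]
      exact ⟨fun ha => ⟨ha, hne a ha⟩, fun ha => ha.1⟩
    · rintro p _ ⟨a, ha, rfl⟩
      by_contra! h
      refine hwf a ha (StoneSpace.exists_chain_of_infinite p fun m hm hfin => ?_)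
      refine h m ⟨a, ⟨ha, hm⟩, rfl⟩ ((hfin.image StoneSpace.basic).subset ?_)
      rintro _ ⟨⟨v, ⟨hv, hmv⟩, rfl⟩, hpv⟩
      exact ⟨v, ⟨hv, hpv, hmv⟩, rfl⟩
end
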